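/- Let τ be the constructive abstraction function determined by an admissible intervariable clustering ℂ and intravariable clustering 𝔻 of V_L. For every finite recursive SCM M_H over the high-level variables V_H, there exists a finite recursive SCM M_L over V_L that satisfies the abstract invariance condition with respect to τ and such that M_H is L3-τ consistent with M_L. (Equivalently, the map sending each AIC-satisfying low-level SCM to a high-level SCM that is L3-τ consistent with it is surjective onto the L3-equivalence classes of SCMs over V_H.) -/

import Mathlib

set_option linter.unusedVariables false

open Classical

universe u

/-- A finite recursive structural causal model over endogenous variables `Fin n`
with finite domains `D i`. `Pa i ⊆ {0, …, i-1}` are the endogenous parents of `i`,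
`U` is the finite exogenous sample space with probability mass function `P`, and
`mech i` is the mechanism of variable `i`. -/
structure SCM (n : ℕ) (D : Fin n → Type u) where
  U : Type u
  fintypeU : Fintype U
  P : U → ℝ
  P_nonneg : ∀ u, 0 ≤ P u
  P_sum : (@Finset.univ U fintypeU).sum P = 1
  Pa : Fin n → Finset (Fin n)
  Pa_lt : ∀ i : Fin n, ∀ j ∈ Pa i, j < i
  mech : ∀ i : Fin n, (∀ j ∈ Pa i, D j) → U → D i

attribute [instance] SCM.fintypeU

namespace SCM

variable {n : ℕ} {D : Fin n → Type u}

/-- The potential response `V_[x](u)`: the value of each endogenous variable under the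
intervention fixing the variables of `X` to `x`, with exogenous value `u`. -/
noncomputable def resp (M : SCM n D) (X : Finset (Fin n)) (x : ∀ i ∈ X, D i)
    (u : M.U) : (i : Fin n) → D i
  | i =>
    if h : i ∈ X then x i h
    else M.mech i (fun j hj => M.resp X x u j) u
termination_by i => i.1
decreasing_by exact M.Pa_lt i j hj

end SCM

/-- A counterfactual query: `k` terms, the `j`-th asking that the variables of `Y j`
take the values `y j` under the intervention fixing `X j` to `x j`. -/
structure CtfQuery (n : ℕ) (D : Fin n → Type u) where
  k : ℕ
  Y : Fin k → Finset (Fin n)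
  X : Fin k → Finset (Fin n)
  x : ∀ j : Fin k, ∀ i ∈ X j, D i
  y : ∀ j : Fin k, ∀ i ∈ Y j, D i

/-- The counterfactual probability `P^M(Y¹_[x¹]=y¹, …, Y^k_[x^k]=y^k)`. -/
noncomputable def SCM.ctfProb {n : ℕ} {D : Fin n → Type u} (M : SCM n D)
    (q : CtfQuery n D) : ℝ :=
  ∑ u : M.U,
    if ∀ (j : Fin q.k) (i : Fin n) (h : i ∈ q.Y j),
        M.resp (q.X j) (q.x j) u i = q.y j i h
    then M.P u else 0

/-- `L3(M) = L3(M')`: the two SCMs (over the same variables and domains) assign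
equal probability to every counterfactual query. -/
def L3eq {n : ℕ} {D : Fin n → Type u} (M M' : SCM n D) : Prop :=
  ∀ q : CtfQuery n D, M.ctfProb q = M'.ctfProb q

/-- An intervariable clustering: a partition `C 0, …, C (m-1)` of a subset of the
low-level variables `Fin n` into nonempty, pairwise disjoint clusters, listed in
order. -/
structure InterClustering (n : ℕ) where
  m : ℕ
  C : Fin m → Finset (Fin n)
  nonempty : ∀ i, (C i).Nonempty
  disj : ∀ i j : Fin m, i ≠ j → Disjoint (C i) (C j)

/-- Admissibility of an intervariable clustering with respect to an SCM: in the given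
ordering of the clusters, every endogenous parent of a variable in a cluster lies in
the same cluster or an earlier one. -/
def InterClustering.AdmissibleFor {n : ℕ} {D : Fin n → Type u}
    (cl : InterClustering n) (M : SCM n D) : Prop :=
  ∀ i : Fin cl.m, ∀ v ∈ cl.C i, ∀ p ∈ M.Pa v, ∃ i' : Fin cl.m, i' ≤ i ∧ p ∈ cl.C i'

/-- Admissibility of the clustering itself: the given ordering of the clusters is
compatible with the (topological) ordering of the low-level variables, so that in
any SCM a variable of an earlier cluster may serve as a parent of a variable of a
later cluster. -/
def InterClustering.OrderedAdmissible {n : ℕ} (cl : InterClustering n) : Prop :=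
  ∀ a b : Fin cl.m, a < b → ∀ v ∈ cl.C a, ∀ w ∈ cl.C b, v < w

/-- An intravariable clustering relative to the intervariable clustering `cl`:
for each cluster `i`, a partition of the joint domain `D_{C i}` of the cluster into
nonempty blocks, presented as a surjection `tc i` onto the (finite) set of blocks
`B i`; `B i` is the domain of the `i`-th high-level variable, and `tc i c` is the
unique block containing `c`. -/
structure IntraClustering {n : ℕ} (D : Fin n → Type u) (cl : InterClustering n) where
  B : Fin cl.m → Type u
  fintypeB : ∀ i, Fintype (B i)
  tc : ∀ i : Fin cl.m, (∀ j ∈ cl.C i, D j) → B i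
  tc_surj : ∀ i, Function.Surjective (tc i)

attribute [instance] IntraClustering.fintypeB

namespace IntraClustering

variable {n : ℕ} {D : Fin n → Type u} {cl : InterClustering n}

/-- The constructive abstraction function `τ` determined by the clusterings, on full
low-level assignments. -/
def tau (intra : IntraClustering D cl) (v : ∀ i : Fin n, D i) :
    ∀ i : Fin cl.m, intra.B i :=
  fun i => intra.tc i (fun j _ => v j)

/-- `τ` applied to a value of a union of clusters (`S` is the set of cluster indices,
the union of clusters being `S.biUnion cl.C`). -/
def tauOn (intra : IntraClustering D cl) (S : Finset (Fin cl.m))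
    (x : ∀ v ∈ S.biUnion cl.C, D v) : ∀ i ∈ S, intra.B i :=
  fun i hi => intra.tc i (fun j hj => x j (Finset.mem_biUnion.mpr ⟨i, hi, hj⟩))

end IntraClustering

/-- A low-level counterfactual query whose term sets and intervened sets are unions of
clusters, together with a high-level outcome.  `Ys j` and `Xs j` are the sets of
cluster indices of the `j`-th term, `x j` is the low-level intervention value on the
union of the clusters of `Xs j`, and `yH j` is the high-level outcome of the term. -/
structure AbsQuery {n : ℕ} (D : Fin n → Type u) (cl : InterClustering n)
    (intra : IntraClustering D cl) where
  k : ℕ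
  Ys : Fin k → Finset (Fin cl.m)
  Xs : Fin k → Finset (Fin cl.m)
  x  : ∀ j : Fin k, ∀ v ∈ (Xs j).biUnion cl.C, D v
  yH : ∀ j : Fin k, ∀ i ∈ Ys j, intra.B i

section Values

variable {n : ℕ} {D : Fin n → Type u} {cl : InterClustering n}

/-- The value of the low-level query `Q` under the low-level SCM `M`: the sum, over
all low-level outcome values `y_{L,*}` mapping to the high-level outcome `y_{H,*}`
under `τ`, of the counterfactual probability
`P^M(Y_{L,1[x_{L,1}]} = y_{L,1}, …, Y_{L,k[x_{L,k}]} = y_{L,k})`. -/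
noncomputable def lowValue [∀ i, Fintype (D i)] (M : SCM n D)
    (intra : IntraClustering D cl) (q : AbsQuery D cl intra) : ℝ :=
  ∑ yL : ∀ j : Fin q.k, ∀ v ∈ (q.Ys j).biUnion cl.C, D v,
    if ∀ (j : Fin q.k) (i : Fin cl.m) (hi : i ∈ q.Ys j),
        intra.tauOn (q.Ys j) (yL j) i hi = q.yH j i hi
    then M.ctfProb ⟨q.k, fun j => (q.Ys j).biUnion cl.C,
        fun j => (q.Xs j).biUnion cl.C, q.x, yL⟩
    else 0

/-- The value of the high-level counterpart `τ(Q)` under a high-level SCM `MH`: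
`P^{MH}(τ(Y_{L,1})_{[τ(x_{L,1})]} = y_{H,1}, …)`. -/
noncomputable def highValue (intra : IntraClustering D cl)
    (MH : SCM cl.m intra.B) (q : AbsQuery D cl intra) : ℝ :=
  MH.ctfProb ⟨q.k, q.Ys, q.Xs, fun j => intra.tauOn (q.Xs j) (q.x j), q.yH⟩

/-- `MH` is `Q`-`τ` consistent with `ML`: the value of `Q` induced by `ML` equals the
value of `τ(Q)` induced by `MH`. -/
def QTauConsistent [∀ i, Fintype (D i)] (ML : SCM n D)
    (intra : IntraClustering D cl) (MH : SCM cl.m intra.B)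
    (q : AbsQuery D cl intra) : Prop :=
  lowValue ML intra q = highValue intra MH q

/-- `MH` is `L3`-`τ` consistent with `ML`: `Q`-`τ` consistency holds for every query. -/
def L3TauConsistent [∀ i, Fintype (D i)] (ML : SCM n D)
    (intra : IntraClustering D cl) (MH : SCM cl.m intra.B) : Prop :=
  ∀ q : AbsQuery D cl intra, QTauConsistent ML intra MH q

/-- The abstract invariance condition (AIC): whenever two full low-level assignments
`v1, v2` map to the same high-level value under `τ`, then for every exogenous value
`u` and every cluster `i`, the tuple of mechanism outputs of the cluster's variables
on the `v1`-parent values and on the `v2`-parent values lie in the same block. -/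
def AIC (ML : SCM n D) (intra : IntraClustering D cl) : Prop :=
  ∀ v1 v2 : ∀ i : Fin n, D i, intra.tau v1 = intra.tau v2 →
    ∀ u : ML.U, ∀ i : Fin cl.m,
      intra.tc i (fun j _ => ML.mech j (fun p _ => v1 p) u)
        = intra.tc i (fun j _ => ML.mech j (fun p _ => v2 p) u)

end Values

namespace SCM

variable {n : ℕ} {D : Fin n → Type u}

theorem resp_of_mem (M : SCM n D) {X : Finset (Fin n)} (x : ∀ i ∈ X, D i) (u : M.U)
    {i : Fin n} (h : i ∈ X) : M.resp X x u i = x i h := by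
  rw [resp, dif_pos h]

theorem resp_of_notMem (M : SCM n D) {X : Finset (Fin n)} (x : ∀ i ∈ X, D i) (u : M.U)
    {i : Fin n} (h : i ∉ X) :
    M.resp X x u i = M.mech i (fun j _ => M.resp X x u j) u := by
  rw [resp, dif_neg h]

end SCM

namespace InterClustering

variable {n : ℕ} (cl : InterClustering n)

theorem eq_of_mem {i i' : Fin cl.m} {v : Fin n} (h : v ∈ cl.C i) (h' : v ∈ cl.C i') :
    i = i' := by
  by_contra hne
  exact Finset.disjoint_left.mp (cl.disj i i' hne) h h'

theorem mem_biUnion_iff {S : Finset (Fin cl.m)} {i : Fin cl.m} {v : Fin n}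
    (h : v ∈ cl.C i) : v ∈ S.biUnion cl.C ↔ i ∈ S := by
  refine ⟨fun hv => ?_, fun hi => Finset.mem_biUnion.mpr ⟨i, hi, h⟩⟩
  obtain ⟨i', hi', hv'⟩ := Finset.mem_biUnion.mp hv
  exact cl.eq_of_mem h hv' ▸ hi'

end InterClustering

section Lift

variable {n : ℕ} {D : Fin n → Type u} {cl : InterClustering n}

/-- A low-level SCM realizing `MH`: the variables of a cluster jointly output a chosen
representative of the block that `MH` assigns to the cluster. -/
noncomputable def SCM.lift [∀ i, Nonempty (D i)] (intra : IntraClustering D cl)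
    (hadm : cl.OrderedAdmissible) (MH : SCM cl.m intra.B) : SCM n D where
  U := MH.U
  fintypeU := MH.fintypeU
  P := MH.P
  P_nonneg := MH.P_nonneg
  P_sum := MH.P_sum
  Pa v := Finset.univ.filter fun w => ∃ i, v ∈ cl.C i ∧ ∃ i' ∈ MH.Pa i, w ∈ cl.C i'
  Pa_lt := by
    intro v w hw
    obtain ⟨i, hv, i', hi', hw'⟩ := (Finset.mem_filter.mp hw).2
    exact hadm i' i (MH.Pa_lt i i' hi') w hw' v hv
  mech v pa u :=
    if h : ∃ i, v ∈ cl.C i then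
      Function.surjInv (intra.tc_surj h.choose)
        (MH.mech h.choose (fun p hp => intra.tc p fun w hw =>
          pa w (Finset.mem_filter.mpr
            ⟨Finset.mem_univ w, h.choose, h.choose_spec, p, hp, hw⟩)) u)
        v h.choose_spec
    else Classical.arbitrary (D v)

variable [∀ i, Nonempty (D i)] (intra : IntraClustering D cl)
  (hadm : cl.OrderedAdmissible) (MH : SCM cl.m intra.B)

theorem SCM.tc_lift_mech (v : ∀ i, D i) (u : MH.U) (i : Fin cl.m) :
    intra.tc i (fun j _ => (MH.lift intra hadm).mech j (fun p _ => v p) u) =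
      MH.mech i (fun p _ => intra.tau v p) u := by
  rw [← Function.surjInv_eq (intra.tc_surj i) (MH.mech i (fun p _ => intra.tau v p) u)]
  congr 1
  funext j hj
  have h : ∃ i, j ∈ cl.C i := ⟨i, hj⟩
  obtain rfl : i = h.choose := cl.eq_of_mem hj h.choose_spec
  exact dif_pos h

theorem SCM.tau_lift_resp (S : Finset (Fin cl.m)) (x : ∀ v ∈ S.biUnion cl.C, D v)
    (u : MH.U) (i : Fin cl.m) :
    intra.tau ((MH.lift intra hadm).resp (S.biUnion cl.C) x u) i =
      MH.resp S (intra.tauOn S x) u i := by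
  induction i using WellFoundedLT.induction with
  | ind i ih =>
    by_cases hi : i ∈ S
    · rw [MH.resp_of_mem _ _ hi]
      refine congrArg (intra.tc i) ?_
      funext j hj
      exact SCM.resp_of_mem _ _ _ _
    · rw [MH.resp_of_notMem _ _ hi]
      have hmech : (fun p (_ : p ∈ MH.Pa i) => MH.resp S (intra.tauOn S x) u p) =
          fun p _ => intra.tau ((MH.lift intra hadm).resp (S.biUnion cl.C) x u) p := by
        funext p hp
        exact (ih p (MH.Pa_lt i p hp)).symm
      rw [hmech, ← SCM.tc_lift_mech intra hadm MH]
      refine congrArg (intra.tc i) ?_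
      funext j hj
      exact SCM.resp_of_notMem _ _ _ (by rwa [cl.mem_biUnion_iff hj])

end Lift

/-- The low-level value of a query is the probability that the abstraction of the
potential responses equals the high-level outcome. -/
theorem lowValue_eq_sum {n : ℕ} {D : Fin n → Type u} [∀ i, Fintype (D i)]
    {cl : InterClustering n} (M : SCM n D) (intra : IntraClustering D cl)
    (q : AbsQuery D cl intra) :
    lowValue M intra q = ∑ u : M.U,
      if ∀ (j : Fin q.k) (i : Fin cl.m) (hi : i ∈ q.Ys j),
          intra.tau (M.resp ((q.Xs j).biUnion cl.C) (q.x j) u) i = q.yH j i hi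
      then M.P u else 0 := by
  unfold lowValue SCM.ctfProb
  rw [← Finset.sum_filter, Finset.sum_comm]
  refine Finset.sum_congr rfl fun u _ => ?_
  let r : ∀ j : Fin q.k, ∀ v ∈ (q.Ys j).biUnion cl.C, D v :=
    fun j v _ => M.resp ((q.Xs j).biUnion cl.C) (q.x j) u v
  have hr : ∀ yL : ∀ j : Fin q.k, ∀ v ∈ (q.Ys j).biUnion cl.C, D v,
      (∀ (j : Fin q.k) (i : Fin n) (h : i ∈ (q.Ys j).biUnion cl.C),
        M.resp ((q.Xs j).biUnion cl.C) (q.x j) u i = yL j i h) ↔ r = yL := by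
    simp only [funext_iff, r, implies_true]
  simp only [hr, Finset.sum_ite_eq, Finset.mem_filter, Finset.mem_univ, true_and]
  rfl

/-- **Surjectivity of the abstraction map.**
Let `τ` be the constructive abstraction function determined by an admissible
intervariable clustering `cl` (with cluster order compatible with the variable order)
and an intravariable clustering `intra`.  For every finite recursive SCM `MH` over
the high-level variables, there exists a finite recursive SCM `ML` over the low-level
variables that satisfies the abstract invariance condition with respect to `τ` and
such that `MH` is `L3`-`τ` consistent with `ML`. -/
theorem abstraction_map_surjective {n : ℕ} {D : Fin n → Type u}
    [∀ i, Fintype (D i)] [∀ i, Nonempty (D i)]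
    (cl : InterClustering n) (intra : IntraClustering D cl)
    (hadm : cl.OrderedAdmissible)
    (MH : SCM cl.m intra.B) :
    ∃ ML : SCM n D, AIC ML intra ∧ L3TauConsistent ML intra MH := by
  refine ⟨MH.lift intra hadm, fun v1 v2 h u i => ?_, fun q => ?_⟩
  · exact (MH.tc_lift_mech intra hadm v1 u i).trans
      (h ▸ (MH.tc_lift_mech intra hadm v2 u i).symm)
  · unfold QTauConsistent highValue SCM.ctfProb
    rw [lowValue_eq_sum]
    simp only [← SCM.tau_lift_resp intra hadm MH]
    rfl
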